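/- Let W be a channel from a finite alphabet 𝒳 to a finite alphabet 𝒴, let P_X be an input distribution with output distribution P_Y = P_XW. Assume real numbers a, a′, b, b′, τ, κ > 0 satisfy κ·log(1/τ − 1) > log 2 + 1, 0 < τ < 1/3, 0 < κ < 1, 1 > 1/a + 1/a′, and c := 1 − 1/b − 1/b′ > 0. Let p(K) := P_X×W({(x,y) : W(y|x) ≤ K·P_Y(y)}). Then for any integer M > 0 and any real K > 0 such that ab·p(K) + a′b′·(1/K)·⌈M/c⌉ < 1, there exists an (N, ε, δ)-ID code for W with N = ⌊e^{τM}/(Me)⌋, ε ≤ ab·p(K), and δ ≤ κ + a′b′·(1/K)·⌈M/c⌉. -/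

import Mathlib

open Finset

/-- `p` is a probability distribution on a finite type. -/
def IsDist {Z : Type*} [Fintype Z] (p : Z → ℝ) : Prop :=
  (∀ z, 0 ≤ p z) ∧ ∑ z, p z = 1

/-- `W` is a channel from `A` to `B`. -/
def IsChannel {A B : Type*} [Fintype A] [Fintype B] (W : A → B → ℝ) : Prop :=
  (∀ x y, 0 ≤ W x y) ∧ ∀ x, ∑ y, W x y = 1

/-- Output distribution `PW`. -/
noncomputable def outDist {A B : Type*} [Fintype A] (P : A → ℝ) (W : A → B → ℝ) (y : B) : ℝ :=
  ∑ x, P x * W x y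

/-- Mass of a set under a (sub)distribution. -/
noncomputable def mass {Z : Type*} [Fintype Z] (p : Z → ℝ) (S : Set Z) : ℝ :=
  ∑ z, S.indicator p z

/-- `P×W(S)`. -/
noncomputable def jointMass {A B : Type*} [Fintype A] [Fintype B]
    (P : A → ℝ) (W : A → B → ℝ) (S : Set (A × B)) : ℝ :=
  mass (fun z : A × B => P z.1 * W z.1 z.2) S

/-- Variational distance between (sub)distributions. -/
noncomputable def tvDist {Z : Type*} [Fintype Z] (p q : Z → ℝ) : ℝ :=
  (1 / 2) * ∑ z, |p z - q z|

/-- Partial response `PW^S`. -/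
noncomputable def partialResp {A B : Type*} [Fintype A] [Fintype B]
    (P : A → ℝ) (W : A → B → ℝ) (S : Set (A × B)) (y : B) : ℝ :=
  ∑ x, S.indicator (fun z : A × B => P z.1 * W z.1 z.2) (x, y)

/-- `p` is an `M`-type: every value is an integer multiple of `1/M`. -/
def IsMType {Z : Type*} [Fintype Z] (M : ℕ) (p : Z → ℝ) : Prop :=
  ∀ z, ∃ k : ℕ, p z = (k : ℝ) / M

/-- `(N, ε, δ)`-ID code for channel `W`. -/
structure IsIDCode {A B : Type*} [Fintype A] [Fintype B] (W : A → B → ℝ) (N : ℕ)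
    (P : Fin N → A → ℝ) (D : Fin N → Set B) (ε δ : ℝ) : Prop where
  dist : ∀ i, IsDist (P i)
  typeI : ∀ i, mass (outDist (P i) W) (D i)ᶜ ≤ ε
  typeII : ∀ i j, i ≠ j → mass (outDist (P i) W) (D j) ≤ δ

/-- Existence of an `(N, ε, δ)`-ID code for channel `W`. -/
def ExistsIDCode {A B : Type*} [Fintype A] [Fintype B] (W : A → B → ℝ) (N : ℕ) (ε δ : ℝ) : Prop :=
  ∃ (P : Fin N → A → ℝ) (D : Fin N → Set B), IsIDCode W N P D ε δ

/-- `ε`-information spectrum divergence `D_s^ε(p‖q)`. -/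
noncomputable def Ds {Z : Type*} [Fintype Z] (α : ℝ) (p q : Z → ℝ) : ℝ :=
  sSup {γ : ℝ | mass p {z | p z ≤ Real.exp γ * q z} ≤ α}

/-- Optimal type II error `β_ε(p,q)` of binary hypothesis testing. -/
noncomputable def betaErr {Z : Type*} [Fintype Z] (ε : ℝ) (p q : Z → ℝ) : ℝ :=
  sInf {v : ℝ | ∃ t : Z → ℝ, (∀ z, 0 ≤ t z ∧ t z ≤ 1) ∧
    (∑ z, p z * (1 - t z)) ≤ ε ∧ v = ∑ z, q z * t z}

lemma mass_mono {Z : Type*} [Fintype Z] {p : Z → ℝ} (hp : ∀ z, 0 ≤ p z) {S T : Set Z}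
    (h : S ⊆ T) : mass p S ≤ mass p T :=
  sum_le_sum fun z _ => Set.indicator_le_indicator_of_subset h hp z

lemma mass_nonneg {Z : Type*} [Fintype Z] {p : Z → ℝ} (hp : ∀ z, 0 ≤ p z) (S : Set Z) :
    0 ≤ mass p S :=
  sum_nonneg fun z _ => Set.indicator_nonneg (fun z _ => hp z) z

lemma mass_le_one {Z : Type*} [Fintype Z] {p : Z → ℝ} (hp : IsDist p) (S : Set Z) :
    mass p S ≤ 1 := by
  rw [← hp.2]
  exact sum_le_sum fun z _ => Set.indicator_le_self' (fun z _ => hp.1 z) z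

lemma mass_biUnion_le {Z ι : Type*} [Fintype Z] {p : Z → ℝ} (hp : ∀ z, 0 ≤ p z)
    (s : Finset ι) (U : ι → Set Z) : mass p (⋃ i ∈ s, U i) ≤ ∑ i ∈ s, mass p (U i) := by
  classical
  unfold mass
  rw [sum_comm]
  refine sum_le_sum fun z _ => ?_
  by_cases hz : z ∈ ⋃ i ∈ s, U i
  · rw [Set.indicator_of_mem hz]
    obtain ⟨i, hi, hzi⟩ : ∃ i ∈ s, z ∈ U i := by simpa using hz
    calc p z = (U i).indicator p z := (Set.indicator_of_mem hzi p).symm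
      _ ≤ _ := single_le_sum (f := fun i => (U i).indicator p z)
        (fun j _ => Set.indicator_nonneg (fun z _ => hp z) z) hi
  · rw [Set.indicator_of_notMem hz]
    exact sum_nonneg fun j _ => Set.indicator_nonneg (fun z _ => hp z) z

/-- Markov's inequality for a finite weighted sum, including the degenerate case of mean zero. -/
lemma sum_filter_lt_le_one_div {Ω : Type*} [Fintype Ω] {w X : Ω → ℝ} (hw : ∀ ω, 0 ≤ w ω)
    (hX : ∀ ω, 0 ≤ X ω) {a p : ℝ} (ha : 0 < a) (h : ∑ ω, w ω * X ω ≤ p) :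
    ∑ ω with a * p < X ω, w ω ≤ 1 / a := by
  have hwX : ∀ ω ∈ univ, 0 ≤ w ω * X ω := fun ω _ => mul_nonneg (hw ω) (hX ω)
  have hp : 0 ≤ p := (sum_nonneg hwX).trans h
  rcases hp.eq_or_lt with rfl | hp
  · have h0 := (sum_eq_zero_iff_of_nonneg hwX).1 (h.antisymm (sum_nonneg hwX))
    rw [sum_eq_zero]
    · positivity
    · intro ω hω
      have : 0 < X ω := by simpa using hω
      exact (mul_eq_zero.1 (h0 ω (mem_univ ω))).resolve_right this.ne'
  · have h1 : (∑ ω with a * p < X ω, w ω) * (a * p) ≤ p := by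
      rw [sum_mul]
      calc _ ≤ ∑ ω with a * p < X ω, w ω * X ω :=
            sum_le_sum fun ω hω => mul_le_mul_of_nonneg_left (mem_filter.1 hω).2.le (hw ω)
        _ ≤ ∑ ω, w ω * X ω := sum_le_sum_of_subset_of_nonneg (filter_subset _ _)
            fun ω hω _ => hwX ω hω
        _ ≤ p := h
    rw [le_div_iff₀ ha]
    refine le_of_mul_le_mul_right ?_ hp
    linarith

lemma le_sum_filter_le_and_le {Ω : Type*} [Fintype Ω] {w X Y : Ω → ℝ} (hw : IsDist w)
    (hX : ∀ ω, 0 ≤ X ω) (hY : ∀ ω, 0 ≤ Y ω) {a a' p q : ℝ} (ha : 0 < a) (ha' : 0 < a')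
    (hp : ∑ ω, w ω * X ω ≤ p) (hq : ∑ ω, w ω * Y ω ≤ q) :
    1 - 1 / a - 1 / a' ≤ ∑ ω with X ω ≤ a * p ∧ Y ω ≤ a' * q, w ω := by
  have h1 := sum_filter_lt_le_one_div hw.1 hX ha hp
  have h2 := sum_filter_lt_le_one_div hw.1 hY ha' hq
  have h3 : ∑ ω, w ω ≤ ∑ ω with X ω ≤ a * p ∧ Y ω ≤ a' * q, w ω +
      (∑ ω with a * p < X ω, w ω + ∑ ω with a' * q < Y ω, w ω) := by
    simp only [sum_filter, ← sum_add_distrib]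
    refine sum_le_sum fun ω _ => ?_
    have := hw.1 ω
    split_ifs <;> grind
  rw [hw.2] at h3
  linarith

lemma isDist_prod {X ι : Type*} [Fintype X] [Fintype ι] [DecidableEq ι] {P : X → ℝ} (hP : IsDist P) :
    IsDist fun x : ι → X => ∏ i, P (x i) := by
  refine ⟨fun x => prod_nonneg fun i _ => hP.1 _, ?_⟩
  rw [← Fintype.prod_sum fun (_ : ι) x => P x]
  simp [hP.2]

lemma sum_prod_mul_single {X ι : Type*} [Fintype X] [Fintype ι] [DecidableEq ι]
    {P : X → ℝ} (hP : IsDist P)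
    (k : ι) (f : X → ℝ) :
    ∑ x : ι → X, (∏ i, P (x i)) * f (x k) = ∑ x, P x * f x := by
  have h : ∀ x : ι → X, (∏ i, P (x i)) * f (x k) =
      ∏ i, P (x i) * (if i = k then f (x i) else 1) := fun x => by
    rw [prod_mul_distrib]
    simp
  simp_rw [h]
  rw [← Fintype.prod_sum fun (i : ι) x => P x * (if i = k then f x else 1),
    prod_eq_single k]
  · simp
  · intro i _ hi
    simp [hi, hP.2]
  · simp

lemma sum_prod_mul_pair {X ι : Type*} [Fintype X] [Fintype ι] [DecidableEq ι]
    {P : X → ℝ} (hP : IsDist P)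
    {k l : ι} (hkl : l ≠ k) (f g : X → ℝ) :
    ∑ x : ι → X, (∏ i, P (x i)) * (f (x k) * g (x l)) =
      (∑ x, P x * f x) * ∑ x, P x * g x := by
  have h : ∀ x : ι → X, (∏ i, P (x i)) * (f (x k) * g (x l)) =
      ∏ i, P (x i) * ((if i = k then f (x i) else 1) * (if i = l then g (x i) else 1)) :=
    fun x => by
      rw [prod_mul_distrib, prod_mul_distrib]
      simp
  simp_rw [h]
  rw [← Fintype.prod_sum fun (i : ι) x =>
      P x * ((if i = k then f x else 1) * (if i = l then g x else 1)),
    Fintype.prod_eq_mul k l hkl.symm]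
  · simp [hkl, hkl.symm]
  · rintro i ⟨hi, hi'⟩
    simp [hi, hi', hP.2]

lemma outDist_nonneg {A B : Type*} [Fintype A] {P : A → ℝ} {W : A → B → ℝ}
    (hP : ∀ x, 0 ≤ P x) (hW : ∀ x y, 0 ≤ W x y) (y : B) : 0 ≤ outDist P W y :=
  sum_nonneg fun x _ => mul_nonneg (hP x) (hW x y)

/-- The outputs whose likelihood under input `x` exceeds `K` times their output probability. -/
def thresholdSet {A B : Type*} [Fintype A] (W : A → B → ℝ) (P : A → ℝ) (K : ℝ) (x : A) : Set B :=
  {y | K * outDist P W y < W x y}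

lemma sum_mul_mass_thresholdSet_compl {A B : Type*} [Fintype A] [Fintype B] (W : A → B → ℝ)
    (P : A → ℝ) (K : ℝ) :
    ∑ x, P x * mass (W x) (thresholdSet W P K x)ᶜ =
      jointMass P W {z : A × B | W z.1 z.2 ≤ K * outDist P W z.2} := by
  classical
  simp only [jointMass, mass, Fintype.sum_prod_type, mul_sum, thresholdSet, Set.indicator_apply,
    Set.mem_compl_iff, Set.mem_ofPred_eq, not_lt, mul_ite, mul_zero]

/-- Averaged over an independent pair of codewords, the probability that the output of one
exceeds the threshold of the other is at most `1 / K`. -/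
lemma sum_prod_mul_mass_thresholdSet_le {A B ι : Type*} [Fintype A] [Fintype B] [Fintype ι]
    [DecidableEq ι]
    {W : A → B → ℝ} (hW : IsChannel W) {P : A → ℝ} (hP : IsDist P) {K : ℝ} (hK : 0 < K)
    {k l : ι} (hkl : l ≠ k) :
    ∑ x : ι → A, (∏ i, P (x i)) * mass (W (x k)) (thresholdSet W P K (x l)) ≤ 1 / K := by
  classical
  have h1 : ∀ x : ι → A, (∏ i, P (x i)) * mass (W (x k)) (thresholdSet W P K (x l)) =
      ∑ y, (∏ i, P (x i)) * (W (x k) y * if K * outDist P W y < W (x l) y then 1 else 0) :=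
    fun x => by
      simp [mass, mul_sum, thresholdSet, Set.indicator_apply]
  simp_rw [h1]
  rw [sum_comm]
  have h2 : ∀ y, ∑ x : ι → A, (∏ i, P (x i)) *
      (W (x k) y * if K * outDist P W y < W (x l) y then 1 else 0) ≤ 1 / K * outDist P W y := by
    intro y
    rw [sum_prod_mul_pair hP hkl (fun x => W x y)
      (fun x => if K * outDist P W y < W x y then 1 else 0)]
    change outDist P W y * _ ≤ _
    have hsum : 1 / K * outDist P W y = ∑ x, 1 / K * (P x * W x y) := mul_sum _ _ _
    rw [mul_sum, hsum]
    refine sum_le_sum fun x _ => ?_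
    have hPx := hP.1 x
    have hWx := hW.1 x y
    split_ifs with h
    · have : outDist P W y ≤ 1 / K * W x y := by
        rw [one_div, inv_mul_eq_div, le_div_iff₀ hK]
        linarith
      nlinarith
    · rw [mul_zero, mul_zero]
      positivity
  refine (sum_le_sum fun y _ => h2 y).trans_eq ?_
  rw [← mul_sum]
  simp only [outDist]
  rw [sum_comm]
  simp [← mul_sum, hW.2, hP.2]

/-- Random coding with expurgation: a transmission code with `M` codewords and (possibly
overlapping) threshold decoding sets, with small error probabilities for each codeword. -/
lemma exists_codebook {A B : Type*} [Fintype A] [Fintype B]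
    {W : A → B → ℝ} (hW : IsChannel W) {P : A → ℝ} (hP : IsDist P) {a a' b b' K : ℝ}
    (ha : 0 < a) (ha' : 0 < a') (hb : 0 < b) (hb' : 0 < b')
    (haa' : 1 / a + 1 / a' < 1) (hK : 0 < K) {M n : ℕ} (hn : 0 < n)
    (hMn : (M : ℝ) ≤ n * (1 - 1 / b - 1 / b')) :
    ∃ x : Fin M → A,
      (∀ k, mass (W (x k)) (thresholdSet W P K (x k))ᶜ ≤
        a * b * jointMass P W {z : A × B | W z.1 z.2 ≤ K * outDist P W z.2}) ∧
      ∀ k, mass (W (x k)) (⋃ l ∈ univ.erase k, thresholdSet W P K (x l)) ≤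
        a' * b' * (1 / K) * n := by
  classical
  set p := jointMass P W {z : A × B | W z.1 z.2 ≤ K * outDist P W z.2} with hp
  let U := thresholdSet W P K
  let e₁ : (Fin n → A) → Fin n → ℝ := fun x k => mass (W (x k)) (U (x k))ᶜ
  let e₂ : (Fin n → A) → Fin n → ℝ := fun x k => mass (W (x k)) (⋃ l ∈ univ.erase k, U (x l))
  have he₁ : ∀ x k, 0 ≤ e₁ x k := fun x k => mass_nonneg (hW.1 _) _
  have he₂ : ∀ x k, 0 ≤ e₂ x k := fun x k => mass_nonneg (hW.1 _) _
  have hn' : (0 : ℝ) < n := by exact_mod_cast hn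
  have hunif : IsDist fun _ : Fin n => 1 / (n : ℝ) :=
    ⟨fun _ => by positivity, by simp [hn'.ne']⟩
  have hQ := isDist_prod (ι := Fin n) hP
  have hE₁ : ∑ x : Fin n → A, (∏ i, P (x i)) * ∑ k, 1 / (n : ℝ) * e₁ x k ≤ p := by
    simp_rw [mul_sum, mul_left_comm _ (1 / (n : ℝ))]
    rw [sum_comm]
    simp_rw [← mul_sum]
    have : ∀ k, ∑ x : Fin n → A, (∏ i, P (x i)) * e₁ x k = p := fun k => by
      rw [hp, ← sum_mul_mass_thresholdSet_compl]
      exact sum_prod_mul_single hP k fun x => mass (W x) (U x)ᶜ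
    simp_rw [this]
    simp [hn'.ne']
  have hE₂ : ∑ x : Fin n → A, (∏ i, P (x i)) * ∑ k, 1 / (n : ℝ) * e₂ x k ≤ n * (1 / K) := by
    simp_rw [mul_sum, mul_left_comm _ (1 / (n : ℝ))]
    rw [sum_comm]
    simp_rw [← mul_sum]
    have : ∀ k, ∑ x : Fin n → A, (∏ i, P (x i)) * e₂ x k ≤ n * (1 / K) := fun k => by
      calc _ ≤ ∑ x : Fin n → A, (∏ i, P (x i)) * ∑ l ∈ univ.erase k, mass (W (x k)) (U (x l)) :=
            sum_le_sum fun x _ => mul_le_mul_of_nonneg_left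
              (mass_biUnion_le (hW.1 _) _ _) (hQ.1 x)
        _ = ∑ l ∈ univ.erase k, ∑ x : Fin n → A, (∏ i, P (x i)) * mass (W (x k)) (U (x l)) := by
            simp_rw [mul_sum]
            rw [sum_comm]
        _ ≤ ∑ l ∈ univ.erase k, 1 / K := sum_le_sum fun l hl =>
            sum_prod_mul_mass_thresholdSet_le hW hP hK (ne_of_mem_erase hl)
        _ ≤ ∑ l : Fin n, 1 / K := sum_le_sum_of_subset_of_nonneg (erase_subset _ _)
            fun _ _ _ => by positivity
        _ = n * (1 / K) := by simp
    calc _ ≤ 1 / (n : ℝ) * ∑ k : Fin n, n * (1 / K) := by gcongr with k; exact this k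
      _ = n * (1 / K) := by simp [hn'.ne']
  obtain ⟨x, hx₁, hx₂⟩ : ∃ x : Fin n → A, ∑ k, 1 / (n : ℝ) * e₁ x k ≤ a * p ∧
      ∑ k, 1 / (n : ℝ) * e₂ x k ≤ a' * (n * (1 / K)) := by
    have h := le_sum_filter_le_and_le hQ
      (fun x => sum_nonneg fun k _ => mul_nonneg (by positivity) (he₁ x k))
      (fun x => sum_nonneg fun k _ => mul_nonneg (by positivity) (he₂ x k)) ha ha' hE₁ hE₂
    obtain ⟨x, hx, -⟩ := exists_ne_zero_of_sum_ne_zero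
      (lt_of_lt_of_le (by linarith) h).ne'
    exact ⟨x, (mem_filter.1 hx).2⟩
  have h := le_sum_filter_le_and_le hunif (he₁ x) (he₂ x) hb hb' hx₁ hx₂
  set G : Finset (Fin n) :=
    {k | e₁ x k ≤ b * (a * p) ∧ e₂ x k ≤ b' * (a' * (n * (1 / K)))} with hG
  have hcard : M ≤ #G := by
    rw [sum_const, nsmul_eq_mul, mul_one_div, le_div_iff₀ hn'] at h
    exact_mod_cast hMn.trans ((mul_comm _ _).trans_le h)
  let σ : Fin M ↪o Fin n := (Fin.castLEOrderEmb hcard).trans (G.orderEmbOfFin rfl)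
  have hσ : ∀ k, σ k ∈ G := fun k => G.orderEmbOfFin_mem rfl _
  refine ⟨x ∘ σ, fun k => ?_, fun k => ?_⟩
  · refine (mem_filter.1 (hσ k)).2.1.trans_eq ?_
    ring
  · calc _ ≤ e₂ x (σ k) := by
          refine mass_mono (hW.1 _) (Set.iUnion₂_subset fun l hl => ?_)
          exact Set.subset_biUnion_of_mem (u := fun l => U (x l)) (x := σ l)
            (mem_coe.2 (mem_erase.2 ⟨fun h => ne_of_mem_erase hl (σ.injective h), mem_univ _⟩))
      _ ≤ b' * (a' * (n * (1 / K))) := (mem_filter.1 (hσ k)).2.2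
      _ = _ := by ring

/-- Gilbert's greedy bound. -/
lemma exists_fin_pairwise_not {α : Type*} [Fintype α] (R : α → α → Prop) [DecidableRel R]
    (hR : ∀ f g, R f g → R g f) {c : ℝ} (hc0 : 0 ≤ c) (hc : ∀ f, (#{g | R f g} : ℝ) ≤ c) (n : ℕ)
    (hn : n * c < Fintype.card α) : ∃ F : Fin n → α, ∀ i j, i ≠ j → ¬ R (F i) (F j) := by
  classical
  induction n with
  | zero => exact ⟨Fin.elim0, fun i => i.elim0⟩
  | succ n ih =>
    have hn' : n * c < Fintype.card α := by push_cast at hn; linarith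
    obtain ⟨F, hF⟩ := ih hn'
    obtain ⟨g, hg⟩ : ∃ g, ∀ i, ¬ R (F i) g := by
      by_contra! h
      have hsub : (univ : Finset α) ⊆ univ.biUnion fun i => {g | R (F i) g} := fun g _ => by
        simpa using h g
      have h1 : (Fintype.card α : ℝ) ≤ ∑ i : Fin n, (#{g | R (F i) g} : ℝ) := by
        exact_mod_cast (card_le_card hsub).trans card_biUnion_le
      have h2 : ∑ i : Fin n, (#{g | R (F i) g} : ℝ) ≤ n * c :=
        (sum_le_sum fun i _ => hc (F i)).trans_eq (by simp)
      linarith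
    refine ⟨Fin.snoc F g, fun i j => ?_⟩
    induction i using Fin.lastCases with
    | last =>
      induction j using Fin.lastCases with
      | last => simp
      | cast j =>
        rw [Fin.snoc_last, Fin.snoc_castSucc]
        exact fun _ h => hg j (hR _ _ h)
    | cast i =>
      induction j using Fin.lastCases with
      | last => simpa using hg i
      | cast j => simpa using hF i j

lemma sum_pow_agreement {m L : ℕ} (f : Fin m → Fin L) (z : ℝ) :
    ∑ g : Fin m → Fin L, z ^ #{s | f s = g s} = (L - 1 + z) ^ m := by
  classical
  have h : ∀ g : Fin m → Fin L, z ^ #{s | f s = g s} = ∏ s, if f s = g s then z else 1 :=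
    fun g => by simp [prod_ite]
  simp_rw [h]
  rw [← Fintype.prod_sum fun s v => if f s = v then z else 1]
  have h' : ∀ s, ∑ v, (if f s = v then z else 1) = L - 1 + z := fun s => by
    have : ∀ v, (if f s = v then z else 1) = 1 + if f s = v then z - 1 else 0 := fun v => by
      split_ifs <;> ring
    simp_rw [this, sum_add_distrib]
    simp
    ring
  simp [h']

/-- A Gilbert-type code: words of length `m` over `L` letters, pairwise agreeing in at most
`κ * m` places. -/
lemma exists_words_few_agreements {m L N : ℕ} (hm : 0 < m) {z κ : ℝ} (hz : 1 ≤ z)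
    (hzL : z ≤ L) (hκz : Real.log 2 + 1 < κ * Real.log z) (hN : (N : ℝ) ≤ Real.exp m) :
    ∃ F : Fin N → Fin m → Fin L, ∀ i j, i ≠ j → (#{s | F i s = F j s} : ℝ) ≤ κ * m := by
  classical
  have hz0 : 0 < z := by linarith
  have hL : (1 : ℝ) ≤ L := hz.trans hzL
  have hzpow : 2 ^ m * Real.exp m ≤ z ^ (κ * m) := by
    have : (2 : ℝ) ^ m * Real.exp m = Real.exp (m * (Real.log 2 + 1)) := by
      rw [mul_add, Real.exp_add, mul_one, Real.exp_nat_mul, Real.exp_log two_pos]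
    rw [this, Real.rpow_def_of_pos hz0, Real.exp_le_exp]
    nlinarith [(Nat.cast_nonneg m : (0 : ℝ) ≤ m)]
  have hcount : ∀ f : Fin m → Fin L,
      (#{g : Fin m → Fin L | κ * m < #{s | f s = g s}} : ℝ) ≤
        (2 * L - 1) ^ m / (2 ^ m * Real.exp m) := fun f => by
    rw [le_div_iff₀ (by positivity)]
    calc _ = ∑ g : Fin m → Fin L with κ * m < #{s | f s = g s}, (2 ^ m * Real.exp m) := by simp
      _ ≤ ∑ g : Fin m → Fin L with κ * m < #{s | f s = g s}, z ^ #{s | f s = g s} := by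
          refine sum_le_sum fun g hg => hzpow.trans ?_
          rw [← Real.rpow_natCast]
          exact Real.rpow_le_rpow_of_exponent_le hz (mem_filter.1 hg).2.le
      _ ≤ ∑ g : Fin m → Fin L, z ^ #{s | f s = g s} :=
          sum_le_sum_of_subset_of_nonneg (filter_subset _ _) fun _ _ _ => by positivity
      _ = (L - 1 + z) ^ m := sum_pow_agreement f z
      _ ≤ (2 * L - 1) ^ m := pow_le_pow_left₀ (by linarith) (by linarith) m
  have h0 : (0 : ℝ) ≤ (2 * L - 1) ^ m := pow_nonneg (by linarith) m
  obtain ⟨F, hF⟩ := exists_fin_pairwise_not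
    (fun f g : Fin m → Fin L => κ * m < (#{s | f s = g s} : ℝ))
    (fun f g h => by simpa only [eq_comm] using h) (div_nonneg h0 (by positivity)) hcount N (by
      calc (N : ℝ) * ((2 * L - 1) ^ m / (2 ^ m * Real.exp m))
          ≤ Real.exp m * ((2 * L - 1) ^ m / (2 ^ m * Real.exp m)) := by gcongr
        _ = (2 * L - 1) ^ m / 2 ^ m := by field_simp
        _ < (2 * L) ^ m / 2 ^ m := by
          gcongr
          · linarith
          · linarith
        _ = _ := by
          rw [mul_pow, mul_div_cancel_left₀ _ (by positivity)]
          simp)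
  exact ⟨F, fun i j hij => not_lt.1 (hF i j hij)⟩

/-- The uniform mixture of point masses at `x 0, …, x (m - 1)`. -/
noncomputable def empiricalDist {A : Type*} {m : ℕ} (x : Fin m → A) : A → ℝ :=
  open Classical in fun z => ∑ s, if x s = z then 1 / (m : ℝ) else 0

lemma isDist_empiricalDist {A : Type*} [Fintype A] {m : ℕ} (hm : 0 < m) (x : Fin m → A) :
    IsDist (empiricalDist x) := by
  classical
  refine ⟨fun z => sum_nonneg fun s _ => by split_ifs <;> positivity, ?_⟩
  simp only [empiricalDist]
  rw [sum_comm]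
  simp [hm.ne']

lemma mass_outDist_empiricalDist {A B : Type*} [Fintype A] [Fintype B] {m : ℕ} (x : Fin m → A)
    (W : A → B → ℝ) (S : Set B) :
    mass (outDist (empiricalDist x) W) S = (∑ s, mass (W (x s)) S) / m := by
  classical
  have h : ∀ y, outDist (empiricalDist x) W y = ∑ s, 1 / (m : ℝ) * W (x s) y := fun y => by
    simp only [outDist, empiricalDist, sum_mul]
    rw [sum_comm]
    simp
  have h' : ∀ y, S.indicator (outDist (empiricalDist x) W) y =
      ∑ s, 1 / (m : ℝ) * S.indicator (W (x s)) y := fun y => by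
    by_cases hy : y ∈ S <;> simp [hy, h]
  simp only [mass, h']
  rw [sum_comm]
  simp_rw [← mul_sum]
  rw [one_div, div_eq_inv_mul]

/-- Concatenating a transmission code on the index set `Fin m × Fin L` with words that pairwise
agree in few places yields an identification code. -/
lemma isIDCode_of_words {A B : Type*} [Fintype A] [Fintype B] {W : A → B → ℝ}
    (hW : IsChannel W) {m L N : ℕ} (hm : 0 < m) {x : Fin m × Fin L → A}
    {U : Fin m × Fin L → Set B} {F : Fin N → Fin m → Fin L} {κ ε δ : ℝ} (hδ : 0 ≤ δ)
    (hε : ∀ k, mass (W (x k)) (U k)ᶜ ≤ ε)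
    (hU : ∀ k, mass (W (x k)) (⋃ l ∈ univ.erase k, U l) ≤ δ)
    (hF : ∀ i j, i ≠ j → (#{s | F i s = F j s} : ℝ) ≤ κ * m) :
    IsIDCode W N (fun i => empiricalDist fun s => x (s, F i s)) (fun i => ⋃ s, U (s, F i s))
      ε (κ + δ) := by
  have hm' : (0 : ℝ) < m := by exact_mod_cast hm
  refine ⟨fun i => isDist_empiricalDist hm _, fun i => ?_, fun i j hij => ?_⟩
  · rw [mass_outDist_empiricalDist, div_le_iff₀ hm']
    calc _ ≤ ∑ s : Fin m, ε := sum_le_sum fun s _ => (mass_mono (hW.1 _)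
          (Set.compl_subset_compl.2 (Set.subset_iUnion (fun s => U (s, F i s)) s))).trans (hε _)
      _ = ε * m := by simp [mul_comm]
  · rw [mass_outDist_empiricalDist, div_le_iff₀ hm']
    calc _ ≤ ∑ s : Fin m, ((if F i s = F j s then 1 else 0) + δ) := by
          refine sum_le_sum fun s _ => ?_
          split_ifs with h
          · linarith [mass_le_one ⟨hW.1 (x (s, F i s)), hW.2 _⟩ (⋃ s, U (s, F j s))]
          · rw [zero_add]
            refine (mass_mono (hW.1 _) (Set.iUnion_subset fun t => ?_)).trans (hU _)
            refine Set.subset_biUnion_of_mem (u := U) (mem_coe.2 (mem_erase.2 ⟨?_, mem_univ _⟩))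
            intro hts
            obtain ⟨rfl, hts⟩ := Prod.mk.inj hts
            exact h hts.symm
      _ = #{s | F i s = F j s} + δ * m := by simp [sum_add_distrib, mul_comm]
      _ ≤ (κ + δ) * m := by linarith [hF i j hij]

/-- Single-shot achievability bound for identification codes
(Lemma 4, Hayashi's bound). -/
theorem single_shot_ID_achievability
    {𝒳 𝒴 : Type*} [Fintype 𝒳] [Fintype 𝒴]
    (W : 𝒳 → 𝒴 → ℝ) (hW : IsChannel W)
    (P : 𝒳 → ℝ) (hP : IsDist P)
    (a a' b b' τ κ : ℝ)
    (ha : 0 < a) (ha' : 0 < a') (hb : 0 < b) (hb' : 0 < b') (hτ0 : 0 < τ) (hκ0 : 0 < κ)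
    (hκτ : Real.log 2 + 1 < κ * Real.log (1 / τ - 1))
    (hτ : τ < 1 / 3) (hκ : κ < 1)
    (haa' : 1 / a + 1 / a' < 1) (hc : 0 < 1 - 1 / b - 1 / b')
    (M : ℕ) (hM : 0 < M) (K : ℝ) (hK : 0 < K)
    (hcond : a * b * jointMass P W {z : 𝒳 × 𝒴 | W z.1 z.2 ≤ K * outDist P W z.2} +
        a' * b' * (1 / K) * (⌈(M : ℝ) / (1 - 1 / b - 1 / b')⌉₊ : ℝ) < 1) :
    ExistsIDCode W ⌊Real.exp (τ * M) / (M * Real.exp 1)⌋₊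
      (a * b * jointMass P W {z : 𝒳 × 𝒴 | W z.1 z.2 ≤ K * outDist P W z.2})
      (κ + a' * b' * (1 / K) * (⌈(M : ℝ) / (1 - 1 / b - 1 / b')⌉₊ : ℝ)) := by
  set n := ⌈(M : ℝ) / (1 - 1 / b - 1 / b')⌉₊ with hn_def
  set m := ⌊τ * M⌋₊ with hm_def
  set N := ⌊Real.exp (τ * M) / (M * Real.exp 1)⌋₊ with hN_def
  have hM' : (1 : ℝ) ≤ M := by exact_mod_cast hM
  have hlt : τ * M < m + 1 := Nat.lt_floor_add_one _
  have hle : (m : ℝ) ≤ τ * M := Nat.floor_le (by positivity)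
  have hNexp : Real.exp (τ * M) / (M * Real.exp 1) ≤ Real.exp (τ * M - 1) := by
    rw [Real.exp_sub, div_mul_eq_div_div_swap]
    exact div_le_self (by positivity) hM'
  have hNle : (N : ℝ) ≤ Real.exp (τ * M - 1) := (Nat.floor_le (by positivity)).trans hNexp
  rcases Nat.eq_zero_or_pos m with hm | hm
  · have hN : N = 0 := by
      have h : Real.exp (τ * M - 1) < 1 := by
        rw [Real.exp_lt_one_iff]
        rw [hm] at hlt
        push_cast at hlt
        linarith
      exact_mod_cast Nat.lt_one_iff.1 (by exact_mod_cast hNle.trans_lt h)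
    rw [hN]
    exact ⟨Fin.elim0, Fin.elim0, fun i => i.elim0, fun i => i.elim0, fun i => i.elim0⟩
  have hm' : (0 : ℝ) < m := by exact_mod_cast hm
  have hMn : (M : ℝ) ≤ n * (1 - 1 / b - 1 / b') := (div_le_iff₀ hc).1 (Nat.le_ceil _)
  have hn : 0 < n := Nat.ceil_pos.2 (by positivity)
  obtain ⟨x, hx₁, hx₂⟩ := exists_codebook hW hP ha ha' hb hb' haa' hK hn hMn
  have hzL : 1 / τ - 1 ≤ ((M / m : ℕ) : ℝ) := by
    have h1 : (M : ℝ) < m * ((M / m : ℕ) + 1) := by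
      exact_mod_cast Nat.lt_mul_div_succ M hm
    rw [sub_le_iff_le_add, div_le_iff₀ hτ0]
    by_contra! h
    nlinarith
  have hz : 1 ≤ 1 / τ - 1 := by
    rw [le_sub_iff_add_le, le_div_iff₀ hτ0]
    linarith
  obtain ⟨F, hF⟩ := exists_words_few_agreements (N := N) hm hz hzL hκτ
    (hNle.trans (Real.exp_le_exp.2 (by linarith)))
  let σ : Fin m × Fin (M / m) ↪ Fin M :=
    finProdFinEquiv.toEmbedding.trans (Fin.castLEEmb (Nat.mul_div_le M m))
  refine ⟨_, _, isIDCode_of_words hW hm (x := x ∘ σ)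
    (U := fun k => thresholdSet W P K (x (σ k))) (by positivity) (fun k => hx₁ (σ k))
    (fun k => ?_) hF⟩
  refine (mass_mono (hW.1 _) (Set.iUnion₂_subset fun l hl => ?_)).trans (hx₂ (σ k))
  exact Set.subset_biUnion_of_mem (u := fun l => thresholdSet W P K (x l)) (x := σ l)
    (mem_coe.2 (mem_erase.2 ⟨fun h => ne_of_mem_erase hl (σ.injective h), mem_univ _⟩))
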